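/- Let n ≥ 1, r ∈ ℝ, f_1,…,f_n ∈ ℝ, and y_1,…,y_n ∈ {0,1}. Define g(ξ) = ∏_{i=1}^n Φ(f_i + rξ)^{y_i}·Φ(−f_i − rξ)^{1−y_i}, n₁ = Σ_{i=1}^n y_i, n₀ = n − n₁, I = ∫_ℝ g(ξ)·φ(ξ) dξ, I_M = ∫_{−M}^{M} g(ξ)·φ(ξ) dξ, and Δ_M = log I − log I_M. Then lim_{M→∞} (1/M²)·log Δ_M = −min{(1 + n₀ r²)/2, (1 + n₁ r²)/2}. -/

import Mathlib

open MeasureTheory Filter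

/-- The standard normal density on `ℝ`. -/
noncomputable def phi (ξ : ℝ) : ℝ := (Real.sqrt (2 * Real.pi))⁻¹ * Real.exp (-ξ ^ 2 / 2)

/-- The standard normal cumulative distribution function. -/
noncomputable def Phi (x : ℝ) : ℝ := ∫ t in Set.Iic x, phi t

open scoped Topology

lemma phi_eq_gaussianPDFReal : phi = ProbabilityTheory.gaussianPDFReal 0 1 := by
  ext x
  simp [phi, ProbabilityTheory.gaussianPDFReal]

lemma phi_pos (x : ℝ) : 0 < phi x := by
  unfold phi
  positivity

lemma integrable_phi : Integrable phi := by
  rw [phi_eq_gaussianPDFReal]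
  exact ProbabilityTheory.integrable_gaussianPDFReal 0 1

lemma integral_phi : ∫ x, phi x = 1 := by
  rw [phi_eq_gaussianPDFReal]
  exact ProbabilityTheory.integral_gaussianPDFReal_eq_one 0 one_ne_zero

lemma log_phi (x : ℝ) : Real.log (phi x) = -Real.log (Real.sqrt (2 * Real.pi)) - x ^ 2 / 2 := by
  unfold phi
  rw [Real.log_mul (by positivity) (by positivity), Real.log_exp, Real.log_inv]
  ring

lemma Phi_le_one (x : ℝ) : Phi x ≤ 1 :=
  integral_phi ▸ setIntegral_le_integral integrable_phi (ae_of_all _ fun t => (phi_pos t).le)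

lemma monotone_Phi : Monotone Phi := fun _ _ hab =>
  setIntegral_mono_set integrable_phi.integrableOn (ae_of_all _ fun t => (phi_pos t).le)
    (Set.Iic_subset_Iic.2 hab).eventuallyLE

/-- Chernoff bound for the lower tail. -/
lemma Phi_le_exp {x : ℝ} (hx : x ≤ 0) : Phi x ≤ Real.exp (-x ^ 2 / 2) := by
  have hint : Integrable fun t => Real.exp (-x ^ 2 / 2) * phi (t - x) :=
    (integrable_phi.comp_sub_right x).const_mul _
  have hnonneg : ∀ t, 0 ≤ Real.exp (-x ^ 2 / 2) * phi (t - x) := fun t =>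
    mul_nonneg (Real.exp_pos _).le (phi_pos _).le
  calc Phi x ≤ ∫ t in Set.Iic x, Real.exp (-x ^ 2 / 2) * phi (t - x) := by
        refine setIntegral_mono_on integrable_phi.integrableOn hint.integrableOn
          measurableSet_Iic fun t ht => ?_
        have ht : t ≤ x := ht
        unfold phi
        rw [mul_left_comm, ← Real.exp_add]
        gcongr
        nlinarith [mul_nonneg_of_nonpos_of_nonpos hx (sub_nonpos.2 ht)]
    _ ≤ ∫ t, Real.exp (-x ^ 2 / 2) * phi (t - x) :=
        setIntegral_le_integral hint (ae_of_all _ hnonneg)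
    _ = Real.exp (-x ^ 2 / 2) := by
        rw [integral_const_mul, integral_sub_right_eq_self phi x, integral_phi, mul_one]

lemma Phi_le_exp_max (x : ℝ) : Phi x ≤ Real.exp (-(max (-x) 0) ^ 2 / 2) := by
  rcases le_total x 0 with hx | hx
  · rw [max_eq_left (neg_nonneg.2 hx), neg_sq]
    exact Phi_le_exp hx
  · rw [max_eq_right (neg_nonpos.2 hx)]
    simpa using Phi_le_one x

lemma phi_le_Phi (x : ℝ) : phi (max (-x) 0 + 1) ≤ Phi x := by
  set m := max (-x) 0
  have hm : 0 ≤ m := le_max_right _ _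
  have hmx : -m ≤ x := neg_le.1 (le_max_left _ _)
  calc phi (m + 1) = ∫ _ in Set.Icc (-m - 1) (-m), phi (m + 1) := by simp
    _ ≤ ∫ t in Set.Icc (-m - 1) (-m), phi t := by
        refine setIntegral_mono_on (by simp) integrable_phi.integrableOn
          measurableSet_Icc fun t ht => ?_
        unfold phi
        gcongr _ * Real.exp (-?_ / 2)
        nlinarith [ht.1, ht.2]
    _ ≤ Phi x := setIntegral_mono_set integrable_phi.integrableOn
        (ae_of_all _ fun t => (phi_pos t).le)
        (Set.Icc_subset_Iic_self.trans (Set.Iic_subset_Iic.2 hmx)).eventuallyLE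

lemma Phi_pos (x : ℝ) : 0 < Phi x := (phi_pos _).trans_le (phi_le_Phi x)

lemma tendsto_const_div_sq (c : ℝ) : Tendsto (fun x : ℝ => c / x ^ 2) atTop (𝓝 0) :=
  tendsto_const_nhds.div_atTop (tendsto_pow_atTop two_ne_zero)

lemma tendsto_log_phi_div_sq :
    Tendsto (fun x => Real.log (phi x) / x ^ 2) atTop (𝓝 (-(1 / 2))) := by
  have h := (tendsto_const_div_sq (-Real.log (Real.sqrt (2 * Real.pi)))).sub
    (tendsto_const_nhds (x := (1 / 2 : ℝ)))
  rw [zero_sub] at h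
  refine h.congr' ?_
  filter_upwards [eventually_gt_atTop 0] with x hx
  rw [log_phi]
  field_simp

lemma tendsto_log_Phi_div_sq (a b : ℝ) :
    Tendsto (fun x => Real.log (Phi (a + b * x)) / x ^ 2) atTop
      (𝓝 (-(max (-b) 0) ^ 2 / 2)) := by
  have hinv (c : ℝ) : Tendsto (fun x : ℝ => c / x) atTop (𝓝 0) :=
    tendsto_const_nhds.div_atTop tendsto_id
  have hmax : Tendsto (fun x => max (-(a / x + b)) 0) atTop (𝓝 (max (-b) 0)) := by
    simpa using (((hinv a).add_const b).neg).max (tendsto_const_nhds (x := (0 : ℝ)))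
  have hscale {x : ℝ} (hx : 0 < x) : max (-(a + b * x)) 0 = max (-(a / x + b)) 0 * x := by
    rw [max_mul_of_nonneg _ _ hx.le, zero_mul]
    congr 1
    field_simp
  have hlow := (tendsto_const_div_sq (-Real.log (Real.sqrt (2 * Real.pi)))).sub
    (((hmax.add (hinv 1)).pow 2).div_const 2)
  rw [add_zero, zero_sub, ← neg_div] at hlow
  refine tendsto_of_tendsto_of_tendsto_of_le_of_le' hlow ((hmax.pow 2).neg.div_const 2) ?_ ?_
  · filter_upwards [eventually_gt_atTop 0] with x hx
    have h := Real.log_le_log (phi_pos _) (phi_le_Phi (a + b * x))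
    rw [log_phi, hscale hx] at h
    rw [le_div_iff₀ (by positivity)]
    refine le_of_eq_of_le ?_ h
    field_simp
  · filter_upwards [eventually_gt_atTop 0] with x hx
    have h := Real.log_le_log (Phi_pos _) (Phi_le_exp_max (a + b * x))
    rw [Real.log_exp, hscale hx] at h
    rw [div_le_iff₀ (by positivity)]
    refine h.trans_eq ?_
    ring

lemma tendsto_log_add_div_sq {u v : ℝ → ℝ} {A B : ℝ} (hu : ∀ x, 0 < u x) (hv : ∀ x, 0 < v x)
    (hA : Tendsto (fun x => Real.log (u x) / x ^ 2) atTop (𝓝 A))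
    (hB : Tendsto (fun x => Real.log (v x) / x ^ 2) atTop (𝓝 B)) :
    Tendsto (fun x => Real.log (u x + v x) / x ^ 2) atTop (𝓝 (max A B)) := by
  have hmax := hA.max hB
  have hup := (tendsto_const_div_sq (Real.log 2)).add hmax
  rw [zero_add] at hup
  refine tendsto_of_tendsto_of_tendsto_of_le_of_le hmax hup (fun x => ?_) fun x => ?_
  · have h₁ := Real.log_le_log (hu x) (le_add_of_nonneg_right (hv x).le)
    have h₂ := Real.log_le_log (hv x) (le_add_of_nonneg_left (hu x).le)
    exact max_le (by gcongr) (by gcongr)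
  · dsimp only
    rw [max_div_div_right (sq_nonneg x), ← add_div]
    gcongr
    rcases le_total (u x) (v x) with h | h
    · calc Real.log (u x + v x) ≤ Real.log (2 * v x) :=
            Real.log_le_log (add_pos (hu x) (hv x)) (by linarith)
        _ = Real.log 2 + Real.log (v x) := Real.log_mul two_ne_zero (hv x).ne'
        _ ≤ _ := by gcongr; exact le_max_right _ _
    · calc Real.log (u x + v x) ≤ Real.log (2 * u x) :=
            Real.log_le_log (add_pos (hu x) (hv x)) (by linarith)
        _ = Real.log 2 + Real.log (u x) := Real.log_mul two_ne_zero (hu x).ne'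
        _ ≤ _ := by gcongr; exact le_max_left _ _

lemma integral_Ioi_pos {h : ℝ → ℝ} (hpos : ∀ x, 0 < h x) (hint : Integrable h) (M : ℝ) :
    0 < ∫ x in Set.Ioi M, h x := by
  refine (integral_pos_iff_support_of_nonneg (fun x => (hpos x).le) hint.integrableOn).2 ?_
  have hsupp : Function.support h = Set.univ := Set.eq_univ_of_forall fun x => (hpos x).ne'
  simp [hsupp]

/-- A Gaussian decay rate of the integrand is inherited by its tail integral. -/
lemma tendsto_log_tail_div_sq {h : ℝ → ℝ} {α : ℝ} (hα : 0 < α) (hpos : ∀ x, 0 < h x)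
    (hint : Integrable h) (hlim : Tendsto (fun x => Real.log (h x) / x ^ 2) atTop (𝓝 (-α))) :
    Tendsto (fun M => Real.log (∫ x in Set.Ioi M, h x) / M ^ 2) atTop (𝓝 (-α)) := by
  have htail_pos := integral_Ioi_pos hpos hint
  refine tendsto_order.2 ⟨fun a ha => ?_, fun b hb => ?_⟩
  · obtain ⟨c, hac, hcα⟩ := exists_between ha
    have hc : c < 0 := by linarith
    obtain ⟨K, hK⟩ := eventually_atTop.1 ((tendsto_order.1 hlim).1 c hcα)
    have hquad : Tendsto (fun M : ℝ => c * (1 + 1 / M) ^ 2) atTop (𝓝 c) := by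
      have h0 : Tendsto (fun M : ℝ => 1 / M) atTop (𝓝 0) :=
        tendsto_const_nhds.div_atTop tendsto_id
      simpa using ((h0.const_add 1).pow 2).const_mul c
    filter_upwards [eventually_ge_atTop K, eventually_gt_atTop 0,
      (tendsto_order.1 hquad).1 a hac] with M hKM hM haM
    have hle : Real.exp (c * (M + 1) ^ 2) ≤ ∫ x in Set.Ioi M, h x :=
      calc Real.exp (c * (M + 1) ^ 2)
          = ∫ _ in Set.Ioc M (M + 1), Real.exp (c * (M + 1) ^ 2) := by simp
        _ ≤ ∫ x in Set.Ioc M (M + 1), h x := by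
            refine setIntegral_mono_on (by simp) hint.integrableOn measurableSet_Ioc
              fun x hx => ?_
            have hx0 : 0 < x := hM.trans hx.1
            rw [← Real.le_log_iff_exp_le (hpos x)]
            have h₁ := (lt_div_iff₀ (by positivity)).1 (hK x (hKM.trans hx.1.le))
            nlinarith [hx.2, mul_le_mul_of_nonpos_left
              (pow_le_pow_left₀ hx0.le hx.2 2) hc.le]
        _ ≤ _ := setIntegral_mono_set hint.integrableOn
            (ae_of_all _ fun x => (hpos x).le) Set.Ioc_subset_Ioi_self.eventuallyLE
    rw [← Real.le_log_iff_exp_le (htail_pos M)] at hle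
    rw [lt_div_iff₀ (by positivity)]
    refine lt_of_lt_of_le ?_ hle
    calc a * M ^ 2 < c * (1 + 1 / M) ^ 2 * M ^ 2 := by gcongr
      _ = c * (M + 1) ^ 2 := by field_simp
  · wlog hb0 : b < 0 generalizing b
    · exact (this (-α / 2) (by linarith) (by linarith)).mono fun M hM => by linarith
    obtain ⟨c, hαc, hcb⟩ := exists_between hb
    obtain ⟨d, hcd, hdb⟩ := exists_between hcb
    have hd : d < 0 := hdb.trans hb0
    obtain ⟨K, hK⟩ := eventually_atTop.1 ((tendsto_order.1 hlim).2 c hαc)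
    have hgauss : Integrable fun x : ℝ => Real.exp (-(d - c) * x ^ 2) :=
      integrable_exp_neg_mul_sq (sub_pos.2 hcd)
    set C := ∫ x : ℝ, Real.exp (-(d - c) * x ^ 2)
    have hC : 0 < C := integral_exp_pos hgauss
    have hconst : Tendsto (fun M : ℝ => d + Real.log C / M ^ 2) atTop (𝓝 d) := by
      simpa using (tendsto_const_div_sq (Real.log C)).const_add d
    filter_upwards [eventually_ge_atTop K, eventually_gt_atTop 0,
      (tendsto_order.1 hconst).2 b hdb] with M hKM hM hbM
    have hle : ∫ x in Set.Ioi M, h x ≤ Real.exp (d * M ^ 2) * C :=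
      calc ∫ x in Set.Ioi M, h x
          ≤ ∫ x in Set.Ioi M, Real.exp (d * M ^ 2) * Real.exp (-(d - c) * x ^ 2) := by
            refine setIntegral_mono_on hint.integrableOn (hgauss.const_mul _).integrableOn
              measurableSet_Ioi fun x hx => ?_
            have hx : M < x := hx
            have hx0 : 0 < x := hM.trans hx
            rw [← Real.exp_add, ← Real.log_le_iff_le_exp (hpos x)]
            have h₁ := (div_lt_iff₀ (by positivity)).1 (hK x (hKM.trans hx.le))
            nlinarith [mul_le_mul_of_nonpos_left (pow_le_pow_left₀ hM.le hx.le 2) hd.le]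
        _ ≤ ∫ x, Real.exp (d * M ^ 2) * Real.exp (-(d - c) * x ^ 2) :=
            setIntegral_le_integral (hgauss.const_mul _) (ae_of_all _ fun x => by positivity)
        _ = _ := integral_const_mul _ _
    have hlog := Real.log_le_log (htail_pos M) hle
    rw [Real.log_mul (Real.exp_pos _).ne' hC.ne', Real.log_exp] at hlog
    refine lt_of_le_of_lt ?_ hbM
    rw [div_le_iff₀ (by positivity), add_mul, div_mul_cancel₀ _ (by positivity)]
    exact hlog

lemma integral_sub_intervalIntegral_eq_tail {h : ℝ → ℝ} (hint : Integrable h) (M : ℝ) :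
    (∫ x, h x) - ∫ x in (-M)..M, h x = ∫ x in Set.Ioi M, (h x + h (-x)) := by
  rw [integral_add hint.integrableOn hint.comp_neg.integrableOn, integral_comp_neg_Ioi,
    ← intervalIntegral.integral_Iic_sub_Iic hint.integrableOn hint.integrableOn,
    ← intervalIntegral.integral_Iic_add_Ioi (b := M) hint.integrableOn hint.integrableOn]
  ring

/-- The logarithmic truncation error has the same Gaussian rate as the worse of the two tails. -/
lemma tendsto_log_log_sub_log_div_sq {h : ℝ → ℝ} {α β : ℝ} (hα : 0 < α) (hβ : 0 < β)
    (hpos : ∀ x, 0 < h x) (hint : Integrable h)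
    (hright : Tendsto (fun x => Real.log (h x) / x ^ 2) atTop (𝓝 (-α)))
    (hleft : Tendsto (fun x => Real.log (h (-x)) / x ^ 2) atTop (𝓝 (-β))) :
    Tendsto (fun M => Real.log (Real.log (∫ x, h x) - Real.log (∫ x in (-M)..M, h x)) / M ^ 2)
      atTop (𝓝 (-(min α β))) := by
  have hsum_pos (x : ℝ) : 0 < h x + h (-x) := add_pos (hpos x) (hpos (-x))
  have hsum_int : Integrable fun x => h x + h (-x) := hint.add hint.comp_neg
  have htail := tendsto_log_tail_div_sq (lt_min hα hβ) hsum_pos hsum_int <| by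
    simpa only [max_neg_neg] using
      tendsto_log_add_div_sq hpos (fun x => hpos (-x)) hright hleft
  set T : ℝ → ℝ := fun M => ∫ x in Set.Ioi M, (h x + h (-x)) with hT
  have hT_pos (M : ℝ) : 0 < T M := integral_Ioi_pos hsum_pos hsum_int M
  set J : ℝ → ℝ := fun M => ∫ x in (-M)..M, h x with hJ
  have hJ_pos {M : ℝ} (hM : 1 ≤ M) : 0 < J M :=
    intervalIntegral.intervalIntegral_pos_of_pos hint.intervalIntegrable hpos (by linarith)
  have hJ_le {M : ℝ} (hM : 1 ≤ M) : J 1 ≤ J M :=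
    intervalIntegral.integral_mono_interval (by linarith) (by linarith) hM
      (ae_of_all _ fun x => (hpos x).le) hint.intervalIntegrable
  have hsplit (M : ℝ) : ∫ x, h x = J M + T M := by
    simp only [hT, hJ, ← integral_sub_intervalIntegral_eq_tail hint M, add_sub_cancel]
  set I := ∫ x, h x
  have hI : 0 < I := by
    rw [hsplit 1]
    exact add_pos (hJ_pos le_rfl) (hT_pos 1)
  have hbound (c : ℝ) : Tendsto (fun M => Real.log (T M) / M ^ 2 + c / M ^ 2) atTop
      (𝓝 (-(min α β))) := by
    simpa using htail.add (tendsto_const_div_sq c)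
  have hlow {M : ℝ} (hM : 1 ≤ M) : T M / I ≤ Real.log I - Real.log (J M) := by
    rw [← Real.log_div hI.ne' (hJ_pos hM).ne']
    refine le_trans (le_of_eq ?_) (Real.one_sub_inv_le_log_of_pos (div_pos hI (hJ_pos hM)))
    rw [inv_div, one_sub_div hI.ne', hsplit M, add_sub_cancel_left]
  have hup {M : ℝ} (hM : 1 ≤ M) : Real.log I - Real.log (J M) ≤ T M / J 1 := by
    rw [← Real.log_div hI.ne' (hJ_pos hM).ne']
    refine (Real.log_le_sub_one_of_pos (div_pos hI (hJ_pos hM))).trans ?_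
    rw [div_sub_one (hJ_pos hM).ne', hsplit M, add_sub_cancel_left]
    exact div_le_div_of_nonneg_left (hT_pos M).le (hJ_pos le_rfl) (hJ_le hM)
  refine tendsto_of_tendsto_of_tendsto_of_le_of_le' (hbound (-Real.log I))
    (hbound (-Real.log (J 1))) ?_ ?_
  · filter_upwards [eventually_ge_atTop 1] with M hM
    rw [← add_div, ← sub_eq_add_neg, ← Real.log_div (hT_pos M).ne' hI.ne']
    have := Real.log_le_log (div_pos (hT_pos M) hI) (hlow hM)
    gcongr
  · filter_upwards [eventually_ge_atTop 1] with M hM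
    rw [← add_div, ← sub_eq_add_neg, ← Real.log_div (hT_pos M).ne' (hJ_pos le_rfl).ne']
    have := Real.log_le_log ((div_pos (hT_pos M) hI).trans_le (hlow hM)) (hup hM)
    gcongr

/-- The Probit conditional likelihood of the binary responses `y` at random effect `ξ`. -/
noncomputable def probitLikelihood {n : ℕ} (r : ℝ) (f : Fin n → ℝ) (y : Fin n → ℕ) (ξ : ℝ) : ℝ :=
  ∏ i, Phi (f i + r * ξ) ^ (y i) * Phi (-(f i) - r * ξ) ^ (1 - y i)

section probitLikelihood

variable {n : ℕ} (r : ℝ) (f : Fin n → ℝ) (y : Fin n → ℕ)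

lemma probitLikelihood_pos (ξ : ℝ) : 0 < probitLikelihood r f y ξ :=
  Finset.prod_pos fun _ _ => mul_pos (pow_pos (Phi_pos _) _) (pow_pos (Phi_pos _) _)

lemma probitLikelihood_le_one (ξ : ℝ) : probitLikelihood r f y ξ ≤ 1 :=
  Finset.prod_le_one
    (fun _ _ => (mul_pos (pow_pos (Phi_pos _) _) (pow_pos (Phi_pos _) _)).le)
    fun _ _ => mul_le_one₀ (pow_le_one₀ (Phi_pos _).le (Phi_le_one _))
      (pow_pos (Phi_pos _) _).le (pow_le_one₀ (Phi_pos _).le (Phi_le_one _))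

lemma measurable_probitLikelihood : Measurable (probitLikelihood r f y) := by
  have := monotone_Phi.measurable
  unfold probitLikelihood
  fun_prop

lemma integrable_probitLikelihood_mul_phi :
    Integrable fun ξ => probitLikelihood r f y ξ * phi ξ := by
  refine integrable_phi.bdd_mul (c := 1) (measurable_probitLikelihood r f y).aestronglyMeasurable
    (ae_of_all _ fun ξ => ?_)
  rw [Real.norm_of_nonneg (probitLikelihood_pos r f y ξ).le]
  exact probitLikelihood_le_one r f y ξ

lemma probitLikelihood_neg (ξ : ℝ) :
    probitLikelihood r f y (-ξ) = probitLikelihood (-r) f y ξ := by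
  simp [probitLikelihood]

lemma phi_neg (ξ : ℝ) : phi (-ξ) = phi ξ := by
  simp [phi]

lemma tendsto_log_probitLikelihood_mul_phi_div_sq :
    Tendsto (fun ξ => Real.log (probitLikelihood r f y ξ * phi ξ) / ξ ^ 2) atTop
      (𝓝 (-((1 + (∑ i, y i : ℕ) * (max (-r) 0) ^ 2
        + (∑ i, (1 - y i) : ℕ) * (max r 0) ^ 2) / 2))) := by
  have hsum := (tendsto_finsetSum Finset.univ fun i _ =>
    ((tendsto_log_Phi_div_sq (f i) r).const_mul (y i : ℝ)).add
      ((tendsto_log_Phi_div_sq (-f i) (-r)).const_mul ((1 - y i : ℕ) : ℝ))).add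
    tendsto_log_phi_div_sq
  convert hsum using 2 with ξ
  · rw [Real.log_mul (probitLikelihood_pos r f y ξ).ne' (phi_pos ξ).ne', add_div,
      probitLikelihood, Real.log_prod fun i _ =>
        (mul_pos (pow_pos (Phi_pos _) _) (pow_pos (Phi_pos _) _)).ne', Finset.sum_div]
    congr 1
    refine Finset.sum_congr rfl fun i _ => ?_
    rw [Real.log_mul (pow_pos (Phi_pos _) _).ne' (pow_pos (Phi_pos _) _).ne', Real.log_pow,
      Real.log_pow, neg_mul, ← sub_eq_add_neg]
    ring
  · rw [Finset.sum_add_distrib, ← Finset.sum_mul, ← Finset.sum_mul, neg_neg]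
    push_cast
    ring

end probitLikelihood

/-- Exact Gaussian tail exponent of the truncation error of the Probit marginal
log-likelihood: `(1/M²)·log Δ_M → −min{(1 + n₀ r²)/2, (1 + n₁ r²)/2}`. -/
theorem stmt_11 (n : ℕ) (hn : 1 ≤ n) (r : ℝ) (f : Fin n → ℝ)
    (y : Fin n → ℕ) (hy : ∀ i, y i ≤ 1)
    (g : ℝ → ℝ)
    (hg : ∀ ξ, g ξ = ∏ i, Phi (f i + r * ξ) ^ (y i) * Phi (-(f i) - r * ξ) ^ (1 - y i))
    (n₁ n₀ : ℕ) (hn₁ : n₁ = ∑ i, y i) (hn₀ : n₀ = n - n₁)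
    (I : ℝ) (hI : I = ∫ ξ : ℝ, g ξ * phi ξ)
    (IM : ℝ → ℝ) (hIM : ∀ M, IM M = ∫ ξ in (-M)..M, g ξ * phi ξ)
    (Δ : ℝ → ℝ) (hΔ : ∀ M, Δ M = Real.log I - Real.log (IM M)) :
    Tendsto (fun M => (1 / M ^ 2) * Real.log (Δ M)) atTop
      (nhds (-(min ((1 + n₀ * r ^ 2) / 2) ((1 + n₁ * r ^ 2) / 2)))) := by
  obtain rfl : g = probitLikelihood r f y := funext hg
  have hn₀' : n₀ = ∑ i, (1 - y i) := by
    have : ∑ i, (1 - y i) + ∑ i, y i = n := by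
      rw [← Finset.sum_add_distrib, Finset.sum_congr rfl fun i _ => Nat.sub_add_cancel (hy i)]
      simp
    omega
  have hright := tendsto_log_probitLikelihood_mul_phi_div_sq r f y
  have hleft := tendsto_log_probitLikelihood_mul_phi_div_sq (-r) f y
  simp only [← probitLikelihood_neg] at hleft
  rw [← hn₁, ← hn₀'] at hright hleft
  rw [neg_neg] at hleft
  have hlim := tendsto_log_log_sub_log_div_sq
    (β := (1 + n₁ * (max r 0) ^ 2 + n₀ * (max (-r) 0) ^ 2) / 2) (by positivity) (by positivity)
    (fun ξ => mul_pos (probitLikelihood_pos r f y ξ) (phi_pos ξ))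
    (integrable_probitLikelihood_mul_phi r f y) hright (by simpa only [phi_neg] using hleft)
  simp only [hΔ, hI, hIM, one_div_mul_eq_div]
  convert hlim using 3
  rcases le_total 0 r with hr | hr
  · simp [hr]
  · rw [min_comm]
    simp [hr]
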